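/- Let Ω be a proper subdomain of a metric space (X,d) satisfying both the C-Gehring–Hayman inequality and the C-ball separation condition, such that (Ω, k_Ω) is geodesic. Then for every geodesic triangle in (Ω,k_Ω) with vertices x₁,x₂,x₃ and every point x₀ on the side γ_{x₁x₂}, one has k_Ω(x₀, γ_{x₁x₃} ∪ γ_{x₂x₃}) ≤ 50·C⁶·(3+C)², i.e., (Ω,k_Ω) is δ-Gromov hyperbolic with δ = 50·C⁶·(3+C)². -/

import Mathlib

open Metric Set Real MeasureTheory

noncomputable section

variable {X : Type*} [MetricSpace X]

/-- Distance from `z` to the complement of `Ω`; for `z` in an open set `Ω` this is the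
distance to the boundary `∂Ω`. -/
def distCompl (Ω : Set X) (z : X) : ℝ := Metric.infDist z Ωᶜ

/-- `γ` restricted to `[0, L]` is a unit-speed (arclength parametrized) rectifiable curve
with values in `Ω`. -/
structure IsUnitSpeedIn (Ω : Set X) (γ : ℝ → X) (L : ℝ) : Prop where
  nonneg : 0 ≤ L
  mem : ∀ t ∈ Set.Icc (0:ℝ) L, γ t ∈ Ω
  unitSpeed : ∀ s ∈ Set.Icc (0:ℝ) L, ∀ t ∈ Set.Icc (0:ℝ) L, s ≤ t →
    eVariationOn γ (Set.Icc s t) = ENNReal.ofReal (t - s)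

/-- Quasihyperbolic length `∫_γ |dz| / d_Ω(z)` of a unit-speed curve in `Ω`
parametrized on `[0, L]`. -/
def qhLength (Ω : Set X) (γ : ℝ → X) (L : ℝ) : ℝ :=
  ∫ s in (0:ℝ)..L, 1 / distCompl Ω (γ s)

/-- Quasihyperbolic distance in `Ω`: infimum of quasihyperbolic lengths of rectifiable
(unit-speed parametrized) curves in `Ω` joining the two points. -/
def qhDist (Ω : Set X) (x y : X) : ℝ :=
  ⨅ p : {p : (ℝ → X) × ℝ // IsUnitSpeedIn Ω p.1 p.2 ∧ p.1 0 = x ∧ p.1 p.2 = y},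
    qhLength Ω p.1.1 p.1.2

/-- Inner (intrinsic) distance in `Ω`: infimum of lengths of rectifiable curves in `Ω`
joining the two points. -/
def innerDist (Ω : Set X) (x y : X) : ℝ :=
  ⨅ p : {p : (ℝ → X) × ℝ // IsUnitSpeedIn Ω p.1 p.2 ∧ p.1 0 = x ∧ p.1 p.2 = y},
    p.1.2

/-- A quasihyperbolic geodesic: a unit-speed curve in `Ω` each of whose subarcs realizes
the quasihyperbolic distance between its endpoints. -/
def IsQHGeodesic (Ω : Set X) (γ : ℝ → X) (L : ℝ) : Prop :=
  IsUnitSpeedIn Ω γ L ∧ ∀ s ∈ Set.Icc (0:ℝ) L, ∀ t ∈ Set.Icc (0:ℝ) L, s ≤ t →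
    (∫ u in s..t, 1 / distCompl Ω (γ u)) = qhDist Ω (γ s) (γ t)

/-- `(Ω, k_Ω)` is a geodesic space: any two points of `Ω` are joined by a
quasihyperbolic geodesic. -/
def QHGeodesicSpace (Ω : Set X) : Prop :=
  ∀ x ∈ Ω, ∀ y ∈ Ω, ∃ γ L, IsQHGeodesic Ω γ L ∧ γ 0 = x ∧ γ L = y

/-- `(Ω, k_Ω)` is `δ`-Gromov hyperbolic: geodesic triangles for the quasihyperbolic
metric are `δ`-thin. -/
def QHGromovHyperbolic (Ω : Set X) (δ : ℝ) : Prop :=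
  ∀ γ₁ L₁ γ₂ L₂ γ₃ L₃, IsQHGeodesic Ω γ₁ L₁ → IsQHGeodesic Ω γ₂ L₂ →
    IsQHGeodesic Ω γ₃ L₃ → γ₂ 0 = γ₁ 0 → γ₃ 0 = γ₁ L₁ → γ₂ L₂ = γ₃ L₃ →
    ∀ s ∈ Set.Icc (0:ℝ) L₁, ∃ u ∈ γ₂ '' Set.Icc (0:ℝ) L₂ ∪ γ₃ '' Set.Icc (0:ℝ) L₃,
      qhDist Ω (γ₁ s) u ≤ δ

/-- The `C`-Gehring–Hayman inequality: every quasihyperbolic geodesic has length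
at most `C` times the inner distance between its endpoints. -/
def GehringHayman (Ω : Set X) (C : ℝ) : Prop :=
  ∀ γ L, IsQHGeodesic Ω γ L → L ≤ C * innerDist Ω (γ 0) (γ L)

/-- The `C`-ball separation condition: for each quasihyperbolic geodesic `γ`, each point
`z` on `γ` and each curve `α` in `Ω` with the same endpoints, the inner-metric ball
`B_σ(z, C·d_Ω(z))` meets `α`. -/
def BallSeparation (Ω : Set X) (C : ℝ) : Prop :=
  ∀ γ L, IsQHGeodesic Ω γ L → ∀ s ∈ Set.Icc (0:ℝ) L,
    ∀ α M, IsUnitSpeedIn Ω α M → α 0 = γ 0 → α M = γ L →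
      ∃ t ∈ Set.Icc (0:ℝ) M, innerDist Ω (γ s) (α t) < C * distCompl Ω (γ s)

/-- `X` is a length space: the distance between any two points is the infimum of lengths
of curves joining them. -/
def IsLengthSpace (X : Type*) [MetricSpace X] : Prop :=
  ∀ x y : X, ∀ ε > 0, ∃ γ : ℝ → X, ∃ L, IsUnitSpeedIn (Set.univ : Set X) γ L ∧
    γ 0 = x ∧ γ L = y ∧ L ≤ dist x y + ε

/-- `X` is `Q`-doubling: every `r/2`-separated subset of a ball of radius `r` has at
most `Q` points. -/
def QDoubling (X : Type*) [MetricSpace X] (Q : ℝ) : Prop :=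
  ∀ x : X, ∀ r : ℝ, ∀ S : Finset X, (↑S : Set X) ⊆ Metric.ball x r →
    (∀ a ∈ S, ∀ b ∈ S, a ≠ b → r / 2 ≤ dist a b) → (S.card : ℝ) ≤ Q

/-- `Ω` is a proper subdomain: a nonempty, open, connected set different from the whole
space. -/
def IsProperSubdomain (Ω : Set X) : Prop :=
  IsOpen Ω ∧ IsConnected Ω ∧ Ω ≠ Set.univ

/-- The `c₀`-LLC-2 condition: points of `Ω` outside a closed ball `B̄(x, r)` can be
joined by a curve in `Ω` outside `B̄(x, r/c₀)`. -/
def LLC2 (Ω : Set X) (c₀ : ℝ) : Prop :=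
  ∀ x : X, ∀ r : ℝ, ∀ a ∈ Ω \ Metric.closedBall x r, ∀ b ∈ Ω \ Metric.closedBall x r,
    ∃ γ L, IsUnitSpeedIn (Ω \ Metric.closedBall x (r / c₀)) γ L ∧ γ 0 = a ∧ γ L = b

theorem Jlem (f : ℝ → ℝ) (τ K0 K η : ℝ) (hτ : 0 ≤ τ) (hη : 0 < η)
    (hf : ∀ s ∈ Set.Icc (0:ℝ) τ, ∀ t ∈ Set.Icc (0:ℝ) τ, |f s - f t| ≤ |s - t|)
    (hK : ∀ t1 t t2, 0 ≤ t1 → t1 ≤ t → t ≤ t2 → t2 ≤ τ → f t1 ≤ K0 → f t2 ≤ K0 → f t ≤ K)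
    (A B : ℝ → Prop)
    (hAB : ∀ t ∈ Set.Icc (0:ℝ) τ, f t ≤ K → A t ∨ B t)
    (htr : ∀ t1 ∈ Set.Icc (0:ℝ) τ, ∀ t2 ∈ Set.Icc (0:ℝ) τ, t2 ≤ t1 + η → A t1 → B t2 → False) :
    (∀ s ∈ Set.Icc (0:ℝ) τ, K0 ≤ f s) ∨
    (∃ t ∈ Set.Icc (0:ℝ) τ, B t ∧ (t = 0 ∨ ∀ s ∈ Set.Icc (0:ℝ) t, K0 ≤ f s)) ∨
    (∃ t ∈ Set.Icc (0:ℝ) τ, A t ∧ (t = τ ∨ ∀ s ∈ Set.Icc t τ, K0 ≤ f s)) := by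
  have hcont : ContinuousOn f (Set.Icc 0 τ) := by
    have : LipschitzOnWith 1 f (Set.Icc 0 τ) := by
      apply LipschitzOnWith.of_dist_le_mul
      intro x hx y hy
      simpa [Real.dist_eq] using hf x hx y hy
    exact this.continuousOn
  have hJc : IsCompact {t | t ∈ Set.Icc (0:ℝ) τ ∧ f t ≤ K0} := by
    have : IsClosed (Set.Icc 0 τ ∩ f ⁻¹' (Set.Iic K0)) :=
      hcont.preimage_isClosed_of_isClosed isClosed_Icc isClosed_Iic
    exact isCompact_Icc.of_isClosed_subset this (fun x hx => hx.1)
  by_cases hne : {t | t ∈ Set.Icc (0:ℝ) τ ∧ f t ≤ K0}.Nonempty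
  swap
  · left
    intro s hs
    by_contra hlt
    exact hne ⟨s, hs, le_of_lt (not_le.mp hlt)⟩
  obtain ⟨m, ⟨hm, hfm⟩, hmin⟩ := hJc.exists_isLeast hne
  obtain ⟨M, ⟨hM, hfM⟩, hmax⟩ := hJc.exists_isGreatest hne
  have hmM : m ≤ M := hmin ⟨hM, hfM⟩
  right
  by_cases hBm : B m
  · left
    refine ⟨m, hm, hBm, ?_⟩
    by_contra hcon
    push Not at hcon
    obtain ⟨hm0, s, hs, hfs⟩ := hcon
    have hmpos : 0 < m := lt_of_le_of_ne hm.1 (Ne.symm hm0)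
    have hsm : s = m := le_antisymm hs.2 (hmin ⟨⟨hs.1, hs.2.trans hm.2⟩, hfs.le⟩)
    subst hsm
    set r := min s (K0 - f s) with hr
    have hr0 : 0 < r := lt_min hmpos (by linarith)
    have hr1 : r ≤ s := min_le_left _ _
    have hr2 : r ≤ K0 - f s := min_le_right _ _
    have hmem : s - r / 2 ∈ Set.Icc (0:ℝ) τ := ⟨by linarith, by linarith [hm.2]⟩
    have h1 := hf (s - r / 2) hmem s hm
    have h2 : |s - r / 2 - s| = r / 2 := by
      rw [show s - r / 2 - s = -(r / 2) by ring, abs_neg, abs_of_pos (by linarith)]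
    rw [h2] at h1
    have h3 := (abs_le.mp h1).2
    have := hmin ⟨hmem, by linarith⟩
    linarith
  right
  have hAm : A m := by
    rcases hAB m hm (hK m m m hm.1 le_rfl le_rfl hm.2 hfm hfm) with h | h
    · exact h
    · exact absurd h hBm
  by_cases hAM : A M
  · refine ⟨M, hM, hAM, ?_⟩
    by_contra hcon
    push Not at hcon
    obtain ⟨hm0, s, hs, hfs⟩ := hcon
    have hmpos : M < τ := lt_of_le_of_ne hM.2 hm0
    have hsm : s = M := le_antisymm (hmax ⟨⟨hM.1.trans hs.1, hs.2⟩, hfs.le⟩) hs.1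
    subst hsm
    set r := min (τ - s) (K0 - f s) with hr
    have hr0 : 0 < r := lt_min (by linarith) (by linarith)
    have hr1 : r ≤ τ - s := min_le_left _ _
    have hr2 : r ≤ K0 - f s := min_le_right _ _
    have hmem : s + r / 2 ∈ Set.Icc (0:ℝ) τ := ⟨by linarith [hM.1], by linarith⟩
    have h1 := hf (s + r / 2) hmem s hM
    have h2 : |s + r / 2 - s| = r / 2 := by
      rw [show s + r / 2 - s = (r / 2) by ring, abs_of_pos (by linarith)]
    rw [h2] at h1
    have h3 := (abs_le.mp h1).2
    have := hmax ⟨hmem, by linarith⟩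
    linarith
  exfalso
  have hor : ∀ t, m ≤ t → t ≤ M → A t ∨ B t := fun t h1 h2 =>
    hAB t ⟨hm.1.trans h1, h2.trans hM.2⟩ (hK m t M hm.1 h1 h2 hM.2 hfm hfM)
  set S := {t | t ∈ Set.Icc m M ∧ A t} with hS
  have hSne : S.Nonempty := ⟨m, ⟨le_rfl, hmM⟩, hAm⟩
  have hSb : BddAbove S := ⟨M, fun t ht => ht.1.2⟩
  obtain ⟨t1, ht1, hlt⟩ := exists_lt_of_lt_csSup hSne (show sSup S - η / 2 < sSup S by linarith)
  have hmS : m ≤ sSup S := le_csSup hSb ⟨⟨le_rfl, hmM⟩, hAm⟩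
  have key : ∀ t2, m ≤ t2 → t2 ≤ M → t2 ≤ sSup S + η / 2 → B t2 → False := by
    intro t2 h1 h2 h3 h4
    exact htr t1 ⟨hm.1.trans ht1.1.1, ht1.1.2.trans hM.2⟩ t2 ⟨hm.1.trans h1, h2.trans hM.2⟩
      (by linarith) ht1.2 h4
  by_cases hc : sSup S + η / 2 ≤ M
  · rcases hor (sSup S + η / 2) (by linarith) hc with h | h
    · have := le_csSup hSb (show sSup S + η / 2 ∈ S from ⟨⟨by linarith, hc⟩, h⟩)
      linarith
    · exact key _ (by linarith) hc le_rfl h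
  · rcases hor M hmM le_rfl with h | h
    · exact hAM h
    · exact key M hmM le_rfl (by linarith) h

structure Cfg (Y : Type*) where
  σ : Y → Y → ℝ
  d : Y → ℝ
  P : Y → Y → Set Y → Prop
  C : ℝ
  x0 : Y
  e : ℝ
  self : ∀ x, σ x x = 0
  symm : ∀ x y, σ x y = σ y x
  tri : ∀ x y z, σ x z ≤ σ x y + σ y z
  lip : ∀ x y, d x ≤ d y + σ x y
  psymm : ∀ x y S, P x y S → P y x S
  ptrans : ∀ x y z S T, P x y S → P y z T → P x z (S ∪ T)
  gap : ∀ x y c, σ x y < c → P x y {p | σ x p + σ p y < c}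
  hC : 1 ≤ C
  he : 0 < e
  hx0 : d x0 = 200 * C ^ 4 * e

namespace Cfg

variable {Y : Type*} (c : Cfg Y)

def E : ℝ := c.C ^ 3 * c.e

def K0 : ℝ := 2 * c.C * c.d c.x0

def K : ℝ := c.K0 * (1 + c.C)

/-- a geodesic, as far as the abstract argument sees it -/
def Geo (γ : ℝ → Y) (L : ℝ) : Prop :=
  0 ≤ L ∧ ∀ s ∈ Set.Icc (0:ℝ) L, ∀ t ∈ Set.Icc (0:ℝ) L, s ≤ t →
    c.σ (γ s) (γ t) ≤ t - s ∧ t - s ≤ c.C * c.σ (γ s) (γ t) ∧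
    c.P (γ s) (γ t) (γ '' Set.Icc s t) ∧
    ∀ z ∈ Set.Icc s t, ∀ S, c.P (γ s) (γ t) S → ∃ p ∈ S, c.σ (γ z) p < c.C * c.d (γ z)

/-- the base side of the triangle, cut at `x0` -/
structure Side (M N : Set Y) (x1 x2 : Y) : Prop where
  memM : x1 ∈ M
  memN : x2 ∈ N
  farM : ∀ u ∈ M, ∀ v ∈ N, c.σ u c.x0 ≤ c.C * c.σ u v
  farN : ∀ u ∈ M, ∀ v ∈ N, c.σ v c.x0 ≤ c.C * c.σ u v
  pM : ∀ u ∈ M, c.P c.x0 u M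
  pN : ∀ u ∈ N, c.P c.x0 u N
  pM1 : ∀ u ∈ M, c.P x1 u M
  pN1 : ∀ u ∈ N, c.P x2 u N
  sep : ∀ u ∈ M, ∀ v ∈ N, ∀ S, c.P u v S → ∃ p ∈ S, c.σ c.x0 p < c.C * c.d c.x0

/-- some thin point separates `x0` from `q` -/
def Cut (q : Y) : Prop :=
  ∃ w, c.d w ≤ c.e ∧ ∀ S, c.P c.x0 q S → ∃ p ∈ S, c.σ w p < c.C * c.d w

variable {c}

theorem Side.swap {M N : Set Y} {x1 x2 : Y} (h : c.Side M N x1 x2) : c.Side N M x2 x1 where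
  memM := h.memN
  memN := h.memM
  farM := fun u hu v hv => by rw [c.symm u v]; exact h.farN v hv u hu
  farN := fun u hu v hv => by rw [c.symm u v]; exact h.farM v hv u hu
  pM := h.pN
  pN := h.pM
  pM1 := h.pN1
  pN1 := h.pM1
  sep := fun u hu v hv S hS => h.sep v hv u hu S (c.psymm _ _ _ hS)

theorem nonneg (x y : Y) : 0 ≤ c.σ x y := by
  have := c.tri x y x
  rw [c.self, c.symm y x] at this
  linarith

theorem E_pos : 0 < c.E := by
  have := c.hC; have := c.he
  unfold E; positivity

theorem e_le : c.e ≤ c.C * c.e ∧ c.C * c.e ≤ c.C ^ 2 * c.e ∧ c.C ^ 2 * c.e ≤ c.E := by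
  have h1 := c.hC
  have h2 := c.he
  have h3 : c.e ≤ c.C * c.e := by nlinarith
  have h4 : c.C * c.e ≤ c.C ^ 2 * c.e := by nlinarith
  refine ⟨h3, h4, ?_⟩
  unfold E
  have : 0 ≤ c.C ^ 2 * c.e := by positivity
  nlinarith

theorem d0_eq : c.d c.x0 = 200 * (c.C * c.E) := by
  rw [c.hx0]; unfold E; ring

theorem E_le_CE : c.E ≤ c.C * c.E := by
  have := c.hC; have := c.E_pos; nlinarith

/-- contact points of thin points -/
theorem contact {w p : Y} (hw : c.d w ≤ c.e) (hp : c.σ w p < c.C * c.d w) :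
    c.σ w p < c.E ∧ c.d p ≤ 2 * c.E ∧ c.C * c.d p ≤ 2 * c.E := by
  obtain ⟨h1, h2, h3⟩ := c.e_le
  have hC := c.hC
  have hle : c.C * c.d w ≤ c.C * c.e := by nlinarith
  have hl := c.lip p w
  rw [c.symm p w] at hl
  refine ⟨by linarith, by linarith, ?_⟩
  have : c.d p ≤ 2 * (c.C * c.e) := by linarith
  have : c.C * c.d p ≤ c.C * (2 * (c.C * c.e)) := by nlinarith
  nlinarith

/-- points near a contact point of level two -/
theorem contact2 {w p v : Y} (hw : c.d w ≤ c.e) (hp : c.σ w p < c.C * c.d w)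
    (hv : c.σ p v < c.C * c.d p ∨ v = p ∨ c.σ w v < c.C * c.d w) : c.C * c.d v ≤ 4 * c.E := by
  obtain ⟨h1, h2, h3⟩ := c.e_le
  have hC := c.hC
  have hle : c.C * c.d w ≤ c.C * c.e := by nlinarith
  have hl := c.lip p w
  rw [c.symm p w] at hl
  have h5 : c.d p ≤ 2 * (c.C * c.e) := by linarith
  rcases hv with hv | hv | hv
  · have h6 : c.C * c.d p ≤ c.C * (2 * (c.C * c.e)) := by nlinarith
    have hl2 := c.lip v p
    rw [c.symm v p] at hl2
    have h7 : c.d v ≤ 4 * (c.C ^ 2 * c.e) := by nlinarith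
    have : c.C * c.d v ≤ c.C * (4 * (c.C ^ 2 * c.e)) := by nlinarith
    unfold E; nlinarith
  · subst hv
    have := (contact hw hp).2.2
    linarith [c.E_pos]
  · have := (contact hw hv).2.2
    linarith [c.E_pos]

theorem fact1 {M N : Set Y} {x1 x2 : Y} (h : c.Side M N x1 x2) {u v : Y} (hu : u ∈ M)
    (hv : v ∈ N) (hs : c.σ u v < 60 * c.E) (hd : c.d u < 60 * c.E) : False := by
  have h1 := h.farM u hu v hv
  have h2 := c.lip c.x0 u
  rw [c.symm c.x0 u, c.d0_eq] at h2
  have := c.hC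
  have h3 : c.C * c.σ u v ≤ c.C * (60 * c.E) := by nlinarith
  have := c.E_le_CE
  have := c.E_pos
  nlinarith

/-- points close to a far point are not in the ball at `x0` -/
theorem far {v p : Y} (hv : c.K0 ≤ c.σ c.x0 v) (hp : c.σ v p < 100 * c.E)
    (hx : c.σ c.x0 p < c.C * c.d c.x0) : False := by
  have h1 := c.tri c.x0 p v
  rw [c.symm p v] at h1
  have h3 : c.K0 = 2 * (c.C * c.d c.x0) := by unfold K0; ring
  have h4 := c.d0_eq
  have := c.hC
  have := c.E_le_CE
  have := c.E_pos
  have : c.d c.x0 ≤ c.C * c.d c.x0 := by nlinarith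
  linarith

theorem Geo.hK {γ : ℝ → Y} {L : ℝ} (h : c.Geo γ L) : ∀ t1 t t2, 0 ≤ t1 → t1 ≤ t → t ≤ t2 →
    t2 ≤ L → c.σ c.x0 (γ t1) ≤ c.K0 → c.σ c.x0 (γ t2) ≤ c.K0 → c.σ c.x0 (γ t) ≤ c.K := by
  intro t1 t t2 h0 h1 h2 h3 h4 h5
  have m1 : t1 ∈ Set.Icc 0 L := ⟨h0, by linarith⟩
  have m2 : t2 ∈ Set.Icc 0 L := ⟨by linarith, by linarith⟩
  have m : t ∈ Set.Icc 0 L := ⟨by linarith, by linarith⟩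
  have a := (h.2 t1 m1 t2 m2 (by linarith)).2.1
  have b := (h.2 t1 m1 t m h1).1
  have b' := (h.2 t m t2 m2 h2).1
  have k1 := c.tri (γ t1) c.x0 (γ t2)
  rw [c.symm (γ t1) c.x0] at k1
  have k2 := c.tri c.x0 (γ t1) (γ t)
  have k3 := c.tri c.x0 (γ t2) (γ t)
  rw [c.symm (γ t2) (γ t)] at k3
  have := c.hC
  have : c.C * c.σ (γ t1) (γ t2) ≤ c.C * (2 * c.K0) := by nlinarith
  have e1 : c.K = c.K0 + c.C * c.K0 := by unfold K; ring
  rcases le_total (t - t1) (t2 - t) with q | q <;> linarith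

theorem Geo.lipf {γ : ℝ → Y} {L : ℝ} (h : c.Geo γ L) : ∀ s ∈ Set.Icc (0:ℝ) L,
    ∀ t ∈ Set.Icc (0:ℝ) L, |c.σ c.x0 (γ s) - c.σ c.x0 (γ t)| ≤ |s - t| := by
  have key : ∀ s ∈ Set.Icc (0:ℝ) L, ∀ t ∈ Set.Icc (0:ℝ) L, s ≤ t →
      |c.σ c.x0 (γ s) - c.σ c.x0 (γ t)| ≤ |s - t| := by
    intro s hs t ht hst
    have a := (h.2 s hs t ht hst).1
    have k1 := c.tri c.x0 (γ s) (γ t)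
    have k2 := c.tri c.x0 (γ t) (γ s)
    rw [c.symm (γ t) (γ s)] at k2
    rw [abs_sub_comm s t, abs_of_nonneg (show 0 ≤ t - s by linarith), abs_le]
    constructor <;> linarith
  intro s hs t ht
  rcases le_total s t with q | q
  · exact key s hs t ht q
  · rw [abs_sub_comm, abs_sub_comm s t]
    exact key t ht s hs q

/-- A geodesic starting at the `N` end cannot come close to `M`. -/
theorem lemmaB {M N : Set Y} {x1 x2 : Y} (hS : c.Side M N x1 x2) {γ : ℝ → Y} {L τ : ℝ}
    (hγ : c.Geo γ L) (h0 : γ 0 = x2)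
    (hcut : ∀ t ∈ Set.Icc (0:ℝ) L, c.σ c.x0 (γ t) ≤ c.K → c.Cut (γ t))
    (hτ : τ ∈ Set.Icc (0:ℝ) L) {u0 : Y} (hu0 : u0 ∈ M) (hg : c.σ u0 (γ τ) < 20 * c.E) :
    False := by
  have hE := c.E_pos
  have hgap := c.gap _ _ _ hg
  have Hgap : ∀ p ∈ {p | c.σ u0 p + c.σ p (γ τ) < 20 * c.E},
      c.σ u0 p < 20 * c.E ∧ c.σ p (γ τ) < 20 * c.E := by
    intro p hp
    have hp' : c.σ u0 p + c.σ p (γ τ) < 20 * c.E := hp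
    have := c.nonneg u0 p
    have := c.nonneg p (γ τ)
    constructor <;> linarith
  have z0 : (0:ℝ) ∈ Set.Icc (0:ℝ) L := ⟨le_rfl, hγ.1⟩
  have sub : ∀ t ∈ Set.Icc (0:ℝ) τ, t ∈ Set.Icc (0:ℝ) L := fun t ht => ⟨ht.1, ht.2.trans hτ.2⟩
  let A : ℝ → Prop := fun t => ∃ u ∈ N, ∃ b ∈ Set.Icc t τ, c.σ u (γ b) < 4 * c.E ∧
    c.C * c.d (γ b) ≤ 2 * c.E ∧ c.d (γ b) ≤ 2 * c.E
  let B : ℝ → Prop := fun t => ∃ u ∈ M, ∃ b ∈ Set.Icc 0 t, c.σ u (γ b) < 24 * c.E ∧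
    c.C * c.d (γ b) ≤ 2 * c.E ∧ c.d (γ b) ≤ 2 * c.E
  have both : ∀ u ∈ M, ∀ u' ∈ N, ∀ v, c.d v ≤ 2 * c.E → c.σ u v < 26 * c.E →
      c.σ u' v < 26 * c.E → False := by
    intro u hu u' hu' v hd h1 h2
    have t1 := c.tri u v u'
    rw [c.symm v u'] at t1
    have t2 := c.lip u v
    exact fact1 hS hu hu' (by linarith) (by linarith)
  have hAB : ∀ t ∈ Set.Icc (0:ℝ) τ, c.σ c.x0 (γ t) ≤ c.K → A t ∨ B t := by
    intro t ht hft
    obtain ⟨w, hw, hcw⟩ := hcut t (sub t ht) hft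
    have hwE : c.d w ≤ 2 * c.E := by obtain ⟨q1, q2, q3⟩ := c.e_le; linarith
    have p1 := c.ptrans _ _ _ _ _ (hS.pN x2 hS.memN) (h0 ▸ (hγ.2 0 z0 t (sub t ht) ht.1).2.2.1)
    have p2 := c.ptrans _ _ _ _ _ (c.ptrans _ _ _ _ _ (hS.pM u0 hu0) hgap)
      (c.psymm _ _ _ (hγ.2 t (sub t ht) τ hτ ht.2).2.2.1)
    obtain ⟨a, ha, hwa⟩ := hcw _ p1
    obtain ⟨b, hb, hwb⟩ := hcw _ p2
    obtain ⟨ca, da, da'⟩ := contact hw hwa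
    obtain ⟨cb, db, db'⟩ := contact hw hwb
    have cab := c.tri a w b
    rw [c.symm a w] at cab
    rcases hb with (hb | hb) | ⟨b, hb, rfl⟩
    · rcases ha with ha | ⟨a, ha, rfl⟩
      · exact (both b hb a ha w hwE (by rw [c.symm]; linarith) (by rw [c.symm]; linarith)).elim
      · exact Or.inr ⟨b, hb, a, ha, by rw [c.symm]; linarith, da', da⟩
    · have := (Hgap b hb).1
      have t1 := c.tri u0 b w
      rw [c.symm b w] at t1
      rcases ha with ha | ⟨a, ha, rfl⟩
      · exact (both u0 hu0 a ha w hwE (by linarith) (by rw [c.symm]; linarith)).elim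
      · have t2 := c.tri u0 w (γ a)
        exact Or.inr ⟨u0, hu0, a, ha, by linarith, da', da⟩
    · rcases ha with ha | ⟨a, ha, rfl⟩
      · exact Or.inl ⟨a, ha, b, hb, by linarith, db', db⟩
      · -- near case
        have p3 := c.ptrans _ _ _ _ _ (c.ptrans _ _ _ _ _ (c.ptrans _ _ _ _ _
          (c.psymm _ _ _ (hS.pN x2 hS.memN)) (hS.pM u0 hu0)) hgap)
          (c.ptrans _ _ _ _ _ (c.gap (γ τ) (γ τ) c.E (by rw [c.self]; exact hE))
            (c.gap (γ τ) (γ τ) c.E (by rw [c.self]; exact hE)))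
        rw [← h0] at p3
        obtain ⟨p, hp, hap⟩ := (hγ.2 0 z0 τ hτ hτ.1).2.2.2 a ⟨ha.1, ha.2.trans ht.2⟩ _ p3
        have g1 := c.tri p (γ a) (γ b)
        rw [c.symm p (γ a)] at g1
        have small : ∀ q, c.σ (γ τ) q + c.σ q (γ τ) < c.E → c.σ (γ τ) q < c.E := by
          intro q hq
          have := c.nonneg q (γ τ)
          linarith
        have viaτ : c.σ (γ τ) p < c.E → A t ∨ B t := by
          intro hq
          have r1 := c.tri u0 (γ τ) (γ a)
          have r2 := c.tri (γ τ) p (γ a)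
          rw [c.symm p (γ a)] at r2
          exact Or.inr ⟨u0, hu0, a, ha, by linarith, da', da⟩
        rcases hp with ((hp | hp) | hp) | (hp | hp)
        · exact Or.inl ⟨p, hp, b, hb, by linarith, db', db⟩
        · exact Or.inr ⟨p, hp, a, ha, by rw [c.symm]; linarith, da', da⟩
        · have := (Hgap p hp).1
          have r1 := c.tri u0 p (γ a)
          rw [c.symm p (γ a)] at r1
          exact Or.inr ⟨u0, hu0, a, ha, by linarith, da', da⟩
        · exact viaτ (small p hp)
        · exact viaτ (small p hp)
  have htr : ∀ t1 ∈ Set.Icc (0:ℝ) τ, ∀ t2 ∈ Set.Icc (0:ℝ) τ, t2 ≤ t1 + c.E → A t1 → B t2 →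
      False := by
    rintro t1 ht1 t2 ht2 h12 ⟨u, hu, a, ha, hua, da, da'⟩ ⟨v, hv, b, hb, hvb, db, db'⟩
    have ma : a ∈ Set.Icc (0:ℝ) L := ⟨ht1.1.trans ha.1, ha.2.trans hτ.2⟩
    have mb : b ∈ Set.Icc (0:ℝ) L := ⟨hb.1, (hb.2.trans ht2.2).trans hτ.2⟩
    rcases le_total b a with hba | hab
    · have p := c.ptrans _ _ _ _ _ (hS.pN1 u hu) (c.gap _ _ _ hua)
      rw [← h0] at p
      obtain ⟨p, hp, hbp⟩ := (hγ.2 0 z0 a ma ma.1).2.2.2 b ⟨hb.1, hba⟩ _ p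
      rcases hp with hp | hp
      · exact both v hv p hp (γ b) db' (by linarith) (by rw [c.symm]; linarith)
      · have hp' : c.σ u p + c.σ p (γ a) < 4 * c.E := hp
        have := c.nonneg p (γ a)
        have := c.tri u p (γ b)
        rw [c.symm p (γ b)] at this
        exact both v hv u hu (γ b) db' (by linarith) (by linarith)
    · have h1 := (hγ.2 a ma b mb hab).1
      have := c.tri u (γ a) (γ b)
      exact both v hv u hu (γ b) db' (by linarith) (by linarith [ha.1, hb.2])
  have hJ := Jlem (fun t => c.σ c.x0 (γ t)) τ c.K0 c.K c.E hτ.1 hE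
    (fun s hs t ht => hγ.lipf s (sub s hs) t (sub t ht))
    (fun t1 t t2 a b d e => hγ.hK t1 t t2 a b d (e.trans hτ.2)) A B hAB htr
  rcases hJ with hJ | ⟨t, ht, ⟨u, hu, b, hb, hub, db, db'⟩, hJ⟩ | ⟨t, ht, ⟨u, hu, b, hb, hub, db, db'⟩, hJ⟩
  · have p := c.ptrans _ _ _ _ _ hgap (c.psymm _ _ _ (hγ.2 0 z0 τ hτ hτ.1).2.2.1)
    rw [h0] at p
    obtain ⟨p, hp, hxp⟩ := hS.sep u0 hu0 x2 hS.memN _ p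
    rcases hp with hp | ⟨s, hs, rfl⟩
    · have := (Hgap p hp).2
      exact far (hJ τ ⟨hτ.1, le_rfl⟩) (by rw [c.symm]; linarith) hxp
    · exact far (hJ s hs) (by rw [c.self]; linarith) hxp
  · rcases hJ with rfl | hJ
    · have : b = 0 := le_antisymm hb.2 hb.1
      subst this
      rw [h0] at hub db'
      exact both u hu x2 hS.memN x2 db' (by linarith) (by rw [c.self]; linarith)
    · have mb : b ∈ Set.Icc (0:ℝ) L := sub b ⟨hb.1, hb.2.trans ht.2⟩
      have p := c.ptrans _ _ _ _ _ (c.gap _ _ _ hub) (c.psymm _ _ _ (hγ.2 0 z0 b mb mb.1).2.2.1)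
      rw [h0] at p
      obtain ⟨p, hp, hxp⟩ := hS.sep u hu x2 hS.memN _ p
      rcases hp with hp | ⟨s, hs, rfl⟩
      · have hp' : c.σ u p + c.σ p (γ b) < 24 * c.E := hp
        have := c.nonneg u p
        exact far (hJ b hb) (by rw [c.symm]; linarith) hxp
      · exact far (hJ s ⟨hs.1, hs.2.trans hb.2⟩) (by rw [c.self]; linarith) hxp
  · rcases hJ with rfl | hJ
    · have : b = t := le_antisymm hb.2 hb.1
      subst this
      exact both u0 hu0 u hu _ db' (by linarith) (by linarith)
    · have mb : b ∈ Set.Icc (0:ℝ) L := ⟨ht.1.trans hb.1, hb.2.trans hτ.2⟩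
      have p := c.ptrans _ _ _ _ _ (c.ptrans _ _ _ _ _ hgap
        (c.psymm _ _ _ (hγ.2 b mb τ hτ hb.2).2.2.1)) (c.psymm _ _ _ (c.gap _ _ _ hub))
      obtain ⟨p, hp, hxp⟩ := hS.sep u0 hu0 u hu _ p
      rcases hp with (hp | ⟨s, hs, rfl⟩) | hp
      · have := (Hgap p hp).2
        exact far (hJ τ ⟨ht.2, le_rfl⟩) (by rw [c.symm]; linarith) hxp
      · exact far (hJ s ⟨hb.1.trans hs.1, hs.2⟩) (by rw [c.self]; linarith) hxp
      · have hp' : c.σ u p + c.σ p (γ b) < 4 * c.E := hp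
        have := c.nonneg u p
        exact far (hJ b hb) (by rw [c.symm]; linarith) hxp

theorem half {M N : Set Y} {x1 x2 : Y} (hS : c.Side M N x1 x2) {γ2 γ3 : ℝ → Y} {L2 L3 : ℝ}
    (h2 : c.Geo γ2 L2) (h3 : c.Geo γ3 L3) (h20 : γ2 0 = x1) (h30 : γ3 0 = x2)
    (hend : γ2 L2 = γ3 L3)
    (hcut : ∀ t ∈ Set.Icc (0:ℝ) L2, c.σ c.x0 (γ2 t) ≤ c.K → c.Cut (γ2 t))
    (LB2 : ∀ t ∈ Set.Icc (0:ℝ) L2, ∀ u ∈ N, c.σ u (γ2 t) < 20 * c.E → False)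
    (LB3 : ∀ t ∈ Set.Icc (0:ℝ) L3, ∀ u ∈ M, c.σ u (γ3 t) < 20 * c.E → False) :
    (∃ u ∈ M, ∃ b ∈ Set.Icc (0:ℝ) L2, c.σ u (γ2 b) < 4 * c.E ∧
      ∀ s ∈ Set.Icc b L2, c.K0 ≤ c.σ c.x0 (γ2 s)) ∨
    (∃ a ∈ Set.Icc (0:ℝ) L2, ∃ a3 ∈ Set.Icc (0:ℝ) L3, c.σ (γ2 a) (γ3 a3) < 4 * c.E ∧
      c.C * c.d (γ2 a) ≤ 2 * c.E ∧ c.C * c.d (γ3 a3) ≤ 4 * c.E ∧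
      ∀ s ∈ Set.Icc 0 a, c.K0 ≤ c.σ c.x0 (γ2 s)) := by
  have hE := c.E_pos
  have z2 : (0:ℝ) ∈ Set.Icc (0:ℝ) L2 := ⟨le_rfl, h2.1⟩
  have z3 : (0:ℝ) ∈ Set.Icc (0:ℝ) L3 := ⟨le_rfl, h3.1⟩
  have l2 : L2 ∈ Set.Icc (0:ℝ) L2 := ⟨h2.1, le_rfl⟩
  have l3 : L3 ∈ Set.Icc (0:ℝ) L3 := ⟨h3.1, le_rfl⟩
  let A : ℝ → Prop := fun t => ∃ u ∈ M, ∃ b ∈ Set.Icc t L2, c.σ u (γ2 b) < 4 * c.E ∧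
    c.C * c.d (γ2 b) ≤ 2 * c.E
  let B : ℝ → Prop := fun t => ∃ a ∈ Set.Icc 0 t, ∃ a3 ∈ Set.Icc (0:ℝ) L3,
    c.σ (γ2 a) (γ3 a3) < 4 * c.E ∧ c.C * c.d (γ2 a) ≤ 2 * c.E ∧ c.C * c.d (γ3 a3) ≤ 4 * c.E
  have p3 : c.P x2 (γ2 L2) (γ3 '' Set.Icc 0 L3) := by
    have := (h3.2 0 z3 L3 l3 h3.1).2.2.1
    rwa [h30, ← hend] at this
  have hAB : ∀ t ∈ Set.Icc (0:ℝ) L2, c.σ c.x0 (γ2 t) ≤ c.K → A t ∨ B t := by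
    intro t ht hft
    obtain ⟨w, hw, hcw⟩ := hcut t ht hft
    have q1 : c.P c.x0 (γ2 t) (M ∪ γ2 '' Set.Icc 0 t) :=
      c.ptrans _ _ _ _ _ (hS.pM x1 hS.memM) (h20 ▸ (h2.2 0 z2 t ht ht.1).2.2.1)
    have q2 : c.P c.x0 (γ2 t) ((N ∪ γ3 '' Set.Icc 0 L3) ∪ γ2 '' Set.Icc t L2) :=
      c.ptrans _ _ _ _ _ (c.ptrans _ _ _ _ _ (hS.pN x2 hS.memN) p3)
        (c.psymm _ _ _ (h2.2 t ht L2 l2 ht.2).2.2.1)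
    obtain ⟨a, ha, hwa⟩ := hcw _ q1
    obtain ⟨b, hb, hwb⟩ := hcw _ q2
    obtain ⟨ca, da, da2⟩ := contact hw hwa
    obtain ⟨cb, db, db2⟩ := contact hw hwb
    have cab := c.tri a w b
    rw [c.symm a w] at cab
    rcases ha with ha | ⟨a, ha, rfl⟩
    · rcases hb with (hb | ⟨b, hb, rfl⟩) | ⟨b, hb, rfl⟩
      · exact (fact1 hS ha hb (by linarith) (by linarith)).elim
      · exact (LB3 b hb a ha (by linarith)).elim
      · exact Or.inl ⟨a, ha, b, hb, by linarith, db2⟩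
    · have ma : a ∈ Set.Icc (0:ℝ) L2 := ⟨ha.1, ha.2.trans ht.2⟩
      rcases hb with (hb | ⟨b, hb, rfl⟩) | ⟨b, hb, rfl⟩
      · exact (LB2 a ma b hb (by rw [c.symm]; linarith)).elim
      · exact Or.inr ⟨a, ha, b, hb, by linarith, da2, by linarith⟩
      · have q3 : c.P (γ2 0) (γ2 L2) ((M ∪ N) ∪ γ3 '' Set.Icc 0 L3) := by
          rw [h20]
          exact c.ptrans _ _ _ _ _ (c.ptrans _ _ _ _ _ (c.psymm _ _ _ (hS.pM x1 hS.memM))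
            (hS.pN x2 hS.memN)) p3
        obtain ⟨p, hp, hap⟩ := (h2.2 0 z2 L2 l2 h2.1).2.2.2 a ma _ q3
        rcases hp with (hp | hp) | ⟨s, hs, rfl⟩
        · have g1 := c.tri p (γ2 a) (γ2 b)
          rw [c.symm p (γ2 a)] at g1
          exact Or.inl ⟨p, hp, b, hb, by linarith, db2⟩
        · exact (LB2 a ma p hp (by rw [c.symm]; linarith)).elim
        · exact Or.inr ⟨a, ha, s, hs, by linarith, da2, contact2 hw hwa (Or.inl hap)⟩
  have htr : ∀ t1 ∈ Set.Icc (0:ℝ) L2, ∀ t2 ∈ Set.Icc (0:ℝ) L2, t2 ≤ t1 + c.E → A t1 → B t2 →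
      False := by
    rintro t1 ht1 t2 ht2 h12 ⟨u, hu, b, hb, hub, db⟩ ⟨a, ha, a3, ha3, haa, da, da3⟩
    have ma : a ∈ Set.Icc (0:ℝ) L2 := ⟨ha.1, ha.2.trans ht2.2⟩
    have mb : b ∈ Set.Icc (0:ℝ) L2 := ⟨ht1.1.trans hb.1, hb.2⟩
    rcases le_total a b with hab | hba
    · have p := c.ptrans _ _ _ _ _ (hS.pM1 u hu) (c.gap _ _ _ hub)
      rw [← h20] at p
      obtain ⟨p, hp, hbp⟩ := (h2.2 0 z2 b mb mb.1).2.2.2 a ⟨ha.1, hab⟩ _ p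
      have k1 := c.tri p (γ2 a) (γ3 a3)
      rw [c.symm p (γ2 a)] at k1
      rcases hp with hp | hp
      · exact LB3 a3 ha3 p hp (by linarith)
      · have hp1 : c.σ u p + c.σ p (γ2 b) < 4 * c.E := hp
        have := c.nonneg p (γ2 b)
        have := c.tri u p (γ3 a3)
        exact LB3 a3 ha3 u hu (by linarith)
    · have k := (h2.2 b mb a ma hba).1
      have k1 := c.tri u (γ2 b) (γ3 a3)
      have k2 := c.tri (γ2 b) (γ2 a) (γ3 a3)
      exact LB3 a3 ha3 u hu (by linarith [hb.1, ha.2])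
  have hJ := Jlem (fun t => c.σ c.x0 (γ2 t)) L2 c.K0 c.K c.E h2.1 hE h2.lipf h2.hK A B hAB htr
  rcases hJ with hJ | ⟨t, ht, ⟨a, ha, a3, ha3, haa, da, da3⟩, hJ⟩ | ⟨t, ht, ⟨u, hu, b, hb, hub, db⟩, hJ⟩
  · exact Or.inl ⟨x1, hS.memM, 0, z2, by rw [h20, c.self]; linarith, hJ⟩
  · rcases hJ with rfl | hJ
    · have : a = 0 := le_antisymm ha.2 ha.1
      subst this
      rw [h20] at haa
      exact (LB3 a3 ha3 x1 hS.memM (by linarith)).elim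
    · exact Or.inr ⟨a, ⟨ha.1, ha.2.trans ht.2⟩, a3, ha3, haa, da, da3,
        fun s hs => hJ s ⟨hs.1, hs.2.trans ha.2⟩⟩
  · rcases hJ with rfl | hJ
    · have : b = t := le_antisymm hb.2 hb.1
      subst this
      rw [hend] at hub
      exact (LB3 L3 l3 u hu (by linarith)).elim
    · exact Or.inl ⟨u, hu, b, ⟨ht.1.trans hb.1, hb.2⟩, hub,
        fun s hs => hJ s ⟨hb.1.trans hs.1, hs.2⟩⟩

/-- mixed case -/
theorem mixed {M N : Set Y} {x1 x2 : Y} (hS : c.Side M N x1 x2) {γ2 γ3 : ℝ → Y} {L2 L3 : ℝ}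
    (h2 : c.Geo γ2 L2) (h3 : c.Geo γ3 L3) (h20 : γ2 0 = x1) (h30 : γ3 0 = x2)
    (LB2 : ∀ t ∈ Set.Icc (0:ℝ) L2, ∀ u ∈ N, c.σ u (γ2 t) < 20 * c.E → False)
    {a a3 b : ℝ} {u : Y} (ha : a ∈ Set.Icc (0:ℝ) L2) (ha3 : a3 ∈ Set.Icc (0:ℝ) L3)
    (haa : c.σ (γ2 a) (γ3 a3) < 4 * c.E) (da3 : c.C * c.d (γ3 a3) ≤ 4 * c.E)
    (hfa : ∀ s ∈ Set.Icc 0 a, c.K0 ≤ c.σ c.x0 (γ2 s))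
    (hu : u ∈ N) (hb : b ∈ Set.Icc (0:ℝ) L3) (hub : c.σ u (γ3 b) < 4 * c.E)
    (hfb : ∀ s ∈ Set.Icc b L3, c.K0 ≤ c.σ c.x0 (γ3 s)) : False := by
  have hE := c.E_pos
  have z2 : (0:ℝ) ∈ Set.Icc (0:ℝ) L2 := ⟨le_rfl, h2.1⟩
  have z3 : (0:ℝ) ∈ Set.Icc (0:ℝ) L3 := ⟨le_rfl, h3.1⟩
  rcases le_total b a3 with hba | hab
  · have p := c.ptrans _ _ _ _ _ (c.ptrans _ _ _ _ _ (c.ptrans _ _ _ _ _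
      (h2.2 0 z2 a ha ha.1).2.2.1 (c.gap _ _ _ haa))
      (c.psymm _ _ _ (h3.2 b hb a3 ha3 hba).2.2.1)) (c.psymm _ _ _ (c.gap _ _ _ hub))
    rw [h20] at p
    obtain ⟨p, hp, hxp⟩ := hS.sep x1 hS.memM u hu _ p
    rcases hp with ((⟨s, hs, rfl⟩ | hp) | ⟨s, hs, rfl⟩) | hp
    · exact far (hfa s hs) (by rw [c.self]; linarith) hxp
    · have hp1 : c.σ (γ2 a) p + c.σ p (γ3 a3) < 4 * c.E := hp
      have := c.nonneg p (γ3 a3)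
      exact far (hfa a ⟨ha.1, le_rfl⟩) (by linarith) hxp
    · exact far (hfb s ⟨hs.1, hs.2.trans ha3.2⟩) (by rw [c.self]; linarith) hxp
    · have hp1 : c.σ u p + c.σ p (γ3 b) < 4 * c.E := hp
      have := c.nonneg u p
      exact far (hfb b ⟨le_rfl, hb.2⟩) (by rw [c.symm]; linarith) hxp
  · have p := c.ptrans _ _ _ _ _ (hS.pN1 u hu) (c.gap _ _ _ hub)
    rw [← h30] at p
    obtain ⟨p, hp, hbp⟩ := (h3.2 0 z3 b hb hb.1).2.2.2 a3 ⟨ha3.1, hab⟩ _ p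
    have k1 := c.tri p (γ3 a3) (γ2 a)
    rw [c.symm p (γ3 a3), c.symm (γ3 a3) (γ2 a)] at k1
    rcases hp with hp | hp
    · exact LB2 a ha p hp (by linarith)
    · have hp1 : c.σ u p + c.σ p (γ3 b) < 4 * c.E := hp
      have := c.nonneg p (γ3 b)
      have := c.tri u p (γ2 a)
      exact LB2 a ha u hu (by linarith)

/-- one half of the crossing case: the crossing point is late -/
theorem late {M N : Set Y} {x1 x2 : Y} (hS : c.Side M N x1 x2) {γ2 γ3 : ℝ → Y} {L2 L3 : ℝ}
    (h2 : c.Geo γ2 L2) (h3 : c.Geo γ3 L3) (h20 : γ2 0 = x1) (h30 : γ3 0 = x2)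
    {a a3 b3 : ℝ} (ha : a ∈ Set.Icc (0:ℝ) L2) (ha3 : a3 ∈ Set.Icc (0:ℝ) L3)
    (haa : c.σ (γ2 a) (γ3 a3) < 4 * c.E)
    (hfa : ∀ s ∈ Set.Icc 0 a, c.K0 ≤ c.σ c.x0 (γ2 s))
    (hfb : ∀ s ∈ Set.Icc 0 b3, c.K0 ≤ c.σ c.x0 (γ3 s)) :
    ∃ t3, b3 < t3 ∧ t3 ∈ Set.Icc 0 a3 ∧ c.σ c.x0 (γ3 t3) < c.C * c.d c.x0 := by
  have hE := c.E_pos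
  have z2 : (0:ℝ) ∈ Set.Icc (0:ℝ) L2 := ⟨le_rfl, h2.1⟩
  have z3 : (0:ℝ) ∈ Set.Icc (0:ℝ) L3 := ⟨le_rfl, h3.1⟩
  have p := c.ptrans _ _ _ _ _ (c.ptrans _ _ _ _ _
      (h2.2 0 z2 a ha ha.1).2.2.1 (c.gap _ _ _ haa))
      (c.psymm _ _ _ (h3.2 0 z3 a3 ha3 ha3.1).2.2.1)
  rw [h20, h30] at p
  obtain ⟨p, hp, hxp⟩ := hS.sep x1 hS.memM x2 hS.memN _ p
  rcases hp with (⟨s, hs, rfl⟩ | hp) | ⟨s, hs, rfl⟩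
  · exact (far (hfa s hs) (by rw [c.self]; linarith) hxp).elim
  · have hp1 : c.σ (γ2 a) p + c.σ p (γ3 a3) < 4 * c.E := hp
    have := c.nonneg p (γ3 a3)
    exact (far (hfa a ⟨ha.1, le_rfl⟩) (by linarith) hxp).elim
  · refine ⟨s, ?_, hs, hxp⟩
    by_contra hle
    exact far (hfb s ⟨hs.1, not_lt.mp hle⟩) (by rw [c.self]; linarith) hxp

theorem triangle {M N : Set Y} {x1 x2 : Y} (hS : c.Side M N x1 x2) {γ2 γ3 : ℝ → Y} {L2 L3 : ℝ}
    (h2 : c.Geo γ2 L2) (h3 : c.Geo γ3 L3) (h20 : γ2 0 = x1) (h30 : γ3 0 = x2)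
    (hend : γ2 L2 = γ3 L3)
    (hcut2 : ∀ t ∈ Set.Icc (0:ℝ) L2, c.σ c.x0 (γ2 t) ≤ c.K → c.Cut (γ2 t))
    (hcut3 : ∀ t ∈ Set.Icc (0:ℝ) L3, c.σ c.x0 (γ3 t) ≤ c.K → c.Cut (γ3 t)) : False := by
  have hE := c.E_pos
  have z2 : (0:ℝ) ∈ Set.Icc (0:ℝ) L2 := ⟨le_rfl, h2.1⟩
  have z3 : (0:ℝ) ∈ Set.Icc (0:ℝ) L3 := ⟨le_rfl, h3.1⟩
  have l2 : L2 ∈ Set.Icc (0:ℝ) L2 := ⟨h2.1, le_rfl⟩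
  have l3 : L3 ∈ Set.Icc (0:ℝ) L3 := ⟨h3.1, le_rfl⟩
  have LB2 : ∀ t ∈ Set.Icc (0:ℝ) L2, ∀ u ∈ N, c.σ u (γ2 t) < 20 * c.E → False :=
    fun t ht u hu h => lemmaB hS.swap h2 h20 hcut2 ht hu h
  have LB3 : ∀ t ∈ Set.Icc (0:ℝ) L3, ∀ u ∈ M, c.σ u (γ3 t) < 20 * c.E → False :=
    fun t ht u hu h => lemmaB hS h3 h30 hcut3 ht hu h
  rcases half hS h2 h3 h20 h30 hend hcut2 LB2 LB3 with
    ⟨u, hu, b, hb, hub, hfb⟩ | ⟨a, ha, a3, ha3, haa, da, da3, hfa⟩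
  · rcases half hS.swap h3 h2 h30 h20 hend.symm hcut3 LB3 LB2 with
      ⟨v, hv, b1, hb1, hvb, hfb1⟩ | ⟨a, ha, a3, ha3, haa, da, da3, hfa⟩
    · have q1 := (h2.2 b hb L2 l2 hb.2).2.2.1
      have q2 := (h3.2 b1 hb1 L3 l3 hb1.2).2.2.1
      rw [hend] at q1
      have p := c.ptrans _ _ _ _ _ (c.ptrans _ _ _ _ _ (c.ptrans _ _ _ _ _
        (c.gap _ _ _ hub) q1) (c.psymm _ _ _ q2)) (c.psymm _ _ _ (c.gap _ _ _ hvb))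
      obtain ⟨p, hp, hxp⟩ := hS.sep u hu v hv _ p
      rcases hp with ((hp | ⟨s, hs, rfl⟩) | ⟨s, hs, rfl⟩) | hp
      · have hp1 : c.σ u p + c.σ p (γ2 b) < 4 * c.E := hp
        have := c.nonneg u p
        exact far (hfb b ⟨le_rfl, hb.2⟩) (by rw [c.symm]; linarith) hxp
      · exact far (hfb s hs) (by rw [c.self]; linarith) hxp
      · exact far (hfb1 s hs) (by rw [c.self]; linarith) hxp
      · have hp1 : c.σ v p + c.σ p (γ3 b1) < 4 * c.E := hp
        have := c.nonneg v p
        exact far (hfb1 b1 ⟨le_rfl, hb1.2⟩) (by rw [c.symm]; linarith) hxp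
    · exact mixed hS.swap h3 h2 h30 h20 LB3 ha ha3 haa da3 hfa hu hb hub hfb
  · rcases half hS.swap h3 h2 h30 h20 hend.symm hcut3 LB3 LB2 with
      ⟨v, hv, b1, hb1, hvb, hfb1⟩ | ⟨b3, hb3, b2, hb2, hbb, db, db2, hfb⟩
    · exact mixed hS h2 h3 h20 h30 LB2 ha ha3 haa da3 hfa hv hb1 hvb hfb1
    · obtain ⟨t3, ht3, ht3a, hx3⟩ := late hS h2 h3 h20 h30 ha ha3 haa hfa hfb
      obtain ⟨t2, ht2, ht2a, hx2⟩ := late hS.swap h3 h2 h30 h20 hb3 hb2 hbb hfb hfa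
      have ab : a ≤ b2 := by linarith [ht2a.2]
      have p : c.P (γ2 0) (γ2 b2) _ := c.ptrans _ _ _ _ _ (c.ptrans _ _ _ _ _ (h20 ▸ c.ptrans _ _ _ _ _
        (c.psymm _ _ _ (hS.pM x1 hS.memM)) (hS.pN x2 hS.memN))
        (h30 ▸ (h3.2 0 z3 b3 hb3 hb3.1).2.2.1)) (c.gap _ _ _ hbb)
      obtain ⟨p, hp, hap⟩ := (h2.2 0 z2 b2 hb2 hb2.1).2.2.2 a ⟨ha.1, ab⟩ _ p
      have fin : ∀ s ∈ Set.Icc 0 b3, c.σ (γ2 a) (γ3 s) < 6 * c.E → False := by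
        intro s hs hsa
        have ms : s ∈ Set.Icc 0 L3 := ⟨hs.1, hs.2.trans hb3.2⟩
        have m3 : t3 ∈ Set.Icc 0 L3 := ⟨ht3a.1, ht3a.2.trans ha3.2⟩
        have g1 := (h3.2 s ms a3 ha3 (by linarith [hs.2, ht3a.2])).2.1
        have g2 := c.tri (γ3 s) (γ2 a) (γ3 a3)
        rw [c.symm (γ3 s) (γ2 a)] at g2
        have g3 := (h3.2 b3 hb3 t3 m3 ht3.le).1
        have g4 := c.tri c.x0 (γ3 t3) (γ3 b3)
        rw [c.symm (γ3 t3) (γ3 b3)] at g4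
        have g5 := hfb b3 ⟨hb3.1, le_rfl⟩
        have hC := c.hC
        have g6 : c.C * c.σ (γ3 s) (γ3 a3) ≤ c.C * (10 * c.E) := by
          apply mul_le_mul_of_nonneg_left _ (by linarith); linarith
        have e1 := c.d0_eq
        have e2 : c.K0 = 2 * (c.C * c.d c.x0) := by unfold K0; ring
        have e3 : c.d c.x0 ≤ c.C * c.d c.x0 := by
          have : 0 ≤ c.C * c.E := by positivity
          nlinarith
        have : 0 < c.C * c.E := by positivity
        linarith [hs.2, ht3a.2]
      rcases hp with ((hp | hp) | ⟨s, hs, rfl⟩) | hp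
      · have g2 := c.tri p (γ2 a) (γ3 a3)
        rw [c.symm p (γ2 a)] at g2
        exact LB3 a3 ha3 p hp (by linarith)
      · exact LB2 a ha p hp (by rw [c.symm]; linarith)
      · exact fin s hs (by linarith)
      · have hp1 : c.σ (γ3 b3) p + c.σ p (γ2 b2) < 4 * c.E := hp
        have := c.nonneg p (γ2 b2)
        have g2 := c.tri (γ2 a) p (γ3 b3)
        rw [c.symm p (γ3 b3)] at g2
        exact fin b3 ⟨hb3.1, le_rfl⟩ (by linarith)

end Cfg

section Concrete

variable {Ω : Set X}

theorem us_shift {γ : ℝ → X} {L s t : ℝ} (h : IsUnitSpeedIn Ω γ L) (hs : 0 ≤ s) (hst : s ≤ t)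
    (ht : t ≤ L) : IsUnitSpeedIn Ω (fun r => γ (s + r)) (t - s) where
  nonneg := by linarith
  mem := fun r hr => h.mem _ ⟨by linarith [hr.1], by linarith [hr.2]⟩
  unitSpeed := fun a ha b hb hab => by
    have h1 := eVariationOn.comp_eq_of_monotoneOn γ (t := Set.Icc a b) (fun r => s + r)
      (fun x _ y _ hxy => by simpa using hxy)
    rw [Set.image_const_add_Icc] at h1
    have h2 := h.unitSpeed (s + a) ⟨by linarith [ha.1], by linarith [ha.2]⟩ (s + b)
      ⟨by linarith [hb.1], by linarith [hb.2]⟩ (by linarith)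
    rw [h2] at h1
    have h3 : (γ ∘ fun r => s + r) = fun r => γ (s + r) := rfl
    rw [h3] at h1
    rw [h1]
    congr 1
    ring

theorem us_rev {γ : ℝ → X} {L : ℝ} (h : IsUnitSpeedIn Ω γ L) :
    IsUnitSpeedIn Ω (fun r => γ (L - r)) L where
  nonneg := h.nonneg
  mem := fun r hr => h.mem _ ⟨by linarith [hr.2], by linarith [hr.1]⟩
  unitSpeed := fun a ha b hb hab => by
    have h1 := eVariationOn.comp_eq_of_antitoneOn γ (t := Set.Icc a b) (fun r => L - r)
      (fun x _ y _ hxy => by simp only; linarith)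
    rw [Set.image_const_sub_Icc] at h1
    have h2 := h.unitSpeed (L - b) ⟨by linarith [hb.2], by linarith [hb.1]⟩ (L - a)
      ⟨by linarith [ha.2], by linarith [ha.1]⟩ (by linarith)
    rw [h2] at h1
    have h3 : (γ ∘ fun r => L - r) = fun r => γ (L - r) := rfl
    rw [h3] at h1
    rw [h1]
    congr 1
    ring

def cat (γ₁ : ℝ → X) (L₁ : ℝ) (γ₂ : ℝ → X) : ℝ → X :=
  fun r => if r ≤ L₁ then γ₁ r else γ₂ (r - L₁)

theorem cat_left {γ₁ γ₂ : ℝ → X} {L₁ r : ℝ} (hr : r ≤ L₁) : cat γ₁ L₁ γ₂ r = γ₁ r := if_pos hr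

theorem cat_right {γ₁ γ₂ : ℝ → X} {L₁ r : ℝ} (h : γ₁ L₁ = γ₂ 0) (hr : L₁ ≤ r) :
    cat γ₁ L₁ γ₂ r = γ₂ (r - L₁) := by
  rcases hr.eq_or_lt with rfl | hr
  · rw [cat_left le_rfl, h, sub_self]
  · exact if_neg (not_le.mpr hr)

theorem us_cat {γ₁ γ₂ : ℝ → X} {L₁ L₂ : ℝ} (h1 : IsUnitSpeedIn Ω γ₁ L₁)
    (h2 : IsUnitSpeedIn Ω γ₂ L₂) (h : γ₁ L₁ = γ₂ 0) :
    IsUnitSpeedIn Ω (cat γ₁ L₁ γ₂) (L₁ + L₂) := by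
  have n1 := h1.nonneg
  have n2 := h2.nonneg
  have kl : ∀ s t, 0 ≤ s → s ≤ t → t ≤ L₁ →
      eVariationOn (cat γ₁ L₁ γ₂) (Set.Icc s t) = ENNReal.ofReal (t - s) := by
    intro s t hs hst ht
    rw [eVariationOn.eq_of_eqOn (f' := γ₁) (fun r hr => cat_left (hr.2.trans ht))]
    exact h1.unitSpeed s ⟨hs, hst.trans ht⟩ t ⟨hs.trans hst, ht⟩ hst
  have kr : ∀ s t, L₁ ≤ s → s ≤ t → t ≤ L₁ + L₂ →
      eVariationOn (cat γ₁ L₁ γ₂) (Set.Icc s t) = ENNReal.ofReal (t - s) := by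
    intro s t hs hst ht
    rw [eVariationOn.eq_of_eqOn (f' := γ₂ ∘ fun r => r - L₁)
      (fun r hr => cat_right h (hs.trans hr.1)),
      eVariationOn.comp_eq_of_monotoneOn γ₂ (fun r => r - L₁)
      (fun x _ y _ hxy => by simpa using hxy), Set.image_sub_const_Icc,
      h2.unitSpeed (s - L₁) ⟨by linarith, by linarith⟩ (t - L₁) ⟨by linarith, by linarith⟩
        (by linarith)]
    congr 1
    ring
  refine ⟨by linarith, ?_, ?_⟩
  · intro t ht
    rcases le_total t L₁ with q | q
    · rw [cat_left q]; exact h1.mem t ⟨ht.1, q⟩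
    · rw [cat_right h q]; exact h2.mem _ ⟨by linarith, by linarith [ht.2]⟩
  · intro s hs t ht hst
    rcases le_total t L₁ with q | q
    · exact kl s t hs.1 hst q
    · rcases le_total L₁ s with q' | q'
      · exact kr s t q' hst ht.2
      · have := eVariationOn.Icc_add_Icc (cat γ₁ L₁ γ₂) (s := Set.univ) q' q (Set.mem_univ _)
        simp only [Set.univ_inter] at this
        rw [← this, kl s L₁ hs.1 q' le_rfl, kr L₁ t le_rfl q ht.2,
          ← ENNReal.ofReal_add (by linarith) (by linarith)]
        congr 1
        ring

theorem us_dist {γ : ℝ → X} {L : ℝ} (h : IsUnitSpeedIn Ω γ L) : dist (γ 0) (γ L) ≤ L := by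
  have h1 := h.unitSpeed 0 ⟨le_rfl, h.nonneg⟩ L ⟨h.nonneg, le_rfl⟩ h.nonneg
  have h2 := eVariationOn.edist_le γ (s := Set.Icc 0 L) (x := 0) (y := L) ⟨le_rfl, h.nonneg⟩
    ⟨h.nonneg, le_rfl⟩
  rw [h1, sub_zero, edist_dist] at h2
  exact (ENNReal.ofReal_le_ofReal_iff h.nonneg).mp h2

theorem us_const {x : X} (hx : x ∈ Ω) : IsUnitSpeedIn Ω (fun _ => x) 0 := by
  refine ⟨le_rfl, fun _ _ => hx, fun s hs t ht hst => ?_⟩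
  have : t - s ≤ 0 := by linarith [hs.1, ht.2]
  rw [ENNReal.ofReal_of_nonpos this]
  apply eVariationOn.constant_on
  intro a ha b hb
  obtain ⟨_, _, rfl⟩ := ha
  obtain ⟨_, _, rfl⟩ := hb
  rfl

theorem inner_bdd (x y : X) : BddBelow (Set.range fun p : {p : (ℝ → X) × ℝ //
    IsUnitSpeedIn Ω p.1 p.2 ∧ p.1 0 = x ∧ p.1 p.2 = y} => p.1.2) := by
  refine ⟨0, ?_⟩
  rintro _ ⟨p, rfl⟩
  exact p.2.1.nonneg

theorem inner_le {γ : ℝ → X} {L : ℝ} {x y : X} (h : IsUnitSpeedIn Ω γ L) (h0 : γ 0 = x)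
    (h1 : γ L = y) : innerDist Ω x y ≤ L :=
  ciInf_le (inner_bdd x y) ⟨(γ, L), h, h0, h1⟩

theorem inner_exists {x y : X} {c : ℝ} (hne : ∃ γ L, IsUnitSpeedIn Ω γ L ∧ γ 0 = x ∧ γ L = y)
    (hc : innerDist Ω x y < c) :
    ∃ γ L, IsUnitSpeedIn Ω γ L ∧ γ 0 = x ∧ γ L = y ∧ L < c := by
  obtain ⟨γ, L, h, h0, h1⟩ := hne
  have : Nonempty {p : (ℝ → X) × ℝ // IsUnitSpeedIn Ω p.1 p.2 ∧ p.1 0 = x ∧ p.1 p.2 = y} :=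
    ⟨⟨(γ, L), h, h0, h1⟩⟩
  obtain ⟨⟨⟨γ, L⟩, h, h0, h1⟩, hlt⟩ := exists_lt_of_ciInf_lt hc
  exact ⟨γ, L, h, h0, h1, hlt⟩

theorem inner_nonneg (x y : X) : 0 ≤ innerDist Ω x y :=
  Real.iInf_nonneg fun p => p.2.1.nonneg

theorem inner_self {x : X} (hx : x ∈ Ω) : innerDist Ω x x = 0 :=
  le_antisymm (inner_le (us_const hx) rfl rfl) (inner_nonneg x x)

def Joined' (Ω : Set X) : Prop :=
  ∀ x ∈ Ω, ∀ y ∈ Ω, ∃ γ L, IsUnitSpeedIn Ω γ L ∧ γ 0 = x ∧ γ L = y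

theorem inner_symm_le (hJ : Joined' Ω) {x y : X} (hx : x ∈ Ω) (hy : y ∈ Ω) :
    innerDist Ω x y ≤ innerDist Ω y x := by
  by_contra hlt
  obtain ⟨γ, L, h, h0, h1, hL⟩ := inner_exists (hJ y hy x hx) (not_le.mp hlt)
  have := inner_le (us_rev h) (x := x) (y := y) (by simpa using h1) (by simpa using h0)
  linarith

theorem inner_tri (hJ : Joined' Ω) {x y z : X} (hx : x ∈ Ω) (hy : y ∈ Ω) (hz : z ∈ Ω) :
    innerDist Ω x z ≤ innerDist Ω x y + innerDist Ω y z := by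
  apply le_of_forall_pos_le_add
  intro ε hε
  obtain ⟨γ, L, h, h0, h1, hL⟩ := inner_exists (hJ x hx y hy)
    (show innerDist Ω x y < innerDist Ω x y + ε / 2 by linarith)
  obtain ⟨γ', L', h', h0', h1', hL'⟩ := inner_exists (hJ y hy z hz)
    (show innerDist Ω y z < innerDist Ω y z + ε / 2 by linarith)
  have hj : γ L = γ' 0 := by rw [h1, h0']
  have := inner_le (us_cat h h' hj) (x := x) (y := z) (by rw [cat_left h.nonneg, h0])
    (by rw [cat_right hj (by linarith [h'.nonneg])]; simpa using h1')
  linarith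

theorem dist_le_inner (hJ : Joined' Ω) {x y : X} (hx : x ∈ Ω) (hy : y ∈ Ω) :
    dist x y ≤ innerDist Ω x y := by
  apply le_of_forall_pos_le_add
  intro ε hε
  obtain ⟨γ, L, h, h0, h1, hL⟩ := inner_exists (hJ x hx y hy)
    (show innerDist Ω x y < innerDist Ω x y + ε by linarith)
  have := us_dist h
  rw [h0, h1] at this
  linarith

theorem geo_sub {γ : ℝ → X} {L s t : ℝ} (h : IsQHGeodesic Ω γ L) (hs : 0 ≤ s) (hst : s ≤ t)
    (ht : t ≤ L) : IsQHGeodesic Ω (fun r => γ (s + r)) (t - s) := by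
  refine ⟨us_shift h.1 hs hst ht, ?_⟩
  intro a ha b hb hab
  rw [← h.2 (s + a) ⟨by linarith [ha.1], by linarith [ha.2]⟩ (s + b)
      ⟨by linarith [hb.1], by linarith [hb.2]⟩ (by linarith)]
  exact intervalIntegral.integral_comp_add_left (fun u => 1 / distCompl Ω (γ u)) s

open Classical in
def lft (o : Ω) (γ : ℝ → X) : ℝ → Ω := fun t => if h : γ t ∈ Ω then ⟨γ t, h⟩ else o

theorem lft_coe (o : Ω) {γ : ℝ → X} {t : ℝ} (h : γ t ∈ Ω) : (lft o γ t : X) = γ t := by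
  unfold lft
  rw [dif_pos h]

theorem lft_eq (o : Ω) {γ : ℝ → X} {t : ℝ} (h : γ t ∈ Ω) : lft o γ t = ⟨γ t, h⟩ :=
  Subtype.ext (lft_coe o h)

def pth (Ω : Set X) (x y : Ω) (S : Set Ω) : Prop :=
  ∃ γ L, IsUnitSpeedIn Ω γ L ∧ γ 0 = x ∧ γ L = y ∧ ∀ t ∈ Set.Icc (0:ℝ) L, ∃ p ∈ S, (p : X) = γ t

def mkCfg (hJ : Joined' Ω) (C : ℝ) (hC : 1 ≤ C) (x0 : Ω) (hx : 0 < distCompl Ω x0) : Cfg Ω where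
  σ := fun x y => innerDist Ω x y
  d := fun x => distCompl Ω x
  P := pth Ω
  C := C
  x0 := x0
  e := distCompl Ω x0 / (200 * C ^ 4)
  self := fun x => inner_self x.2
  symm := fun x y => le_antisymm (inner_symm_le hJ x.2 y.2) (inner_symm_le hJ y.2 x.2)
  tri := fun x y z => inner_tri hJ x.2 y.2 z.2
  lip := fun x y => by
    have h1 := dist_le_inner hJ x.2 y.2
    have h2 : distCompl Ω (x : X) ≤ distCompl Ω (y : X) + dist (x : X) y :=
      Metric.infDist_le_infDist_add_dist
    linarith
  psymm := by
    rintro x y S ⟨γ, L, h, h0, h1, hS⟩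
    exact ⟨_, L, us_rev h, by simpa using h1, by simpa using h0, fun t ht =>
      hS _ ⟨by linarith [ht.2], by linarith [ht.1]⟩⟩
  ptrans := by
    rintro x y z S T ⟨γ, L, h, h0, h1, hS⟩ ⟨γ', L', h', h0', h1', hT⟩
    have hj : γ L = γ' 0 := by rw [h1, h0']
    refine ⟨_, _, us_cat h h' hj, by rw [cat_left h.nonneg, h0],
      by rw [cat_right hj (by linarith [h'.nonneg])]; simpa using h1', fun t ht => ?_⟩
    rcases le_total t L with q | q
    · obtain ⟨p, hp, e⟩ := hS t ⟨ht.1, q⟩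
      exact ⟨p, Or.inl hp, by rw [cat_left q, e]⟩
    · obtain ⟨p, hp, e⟩ := hT (t - L) ⟨by linarith, by linarith [ht.2]⟩
      exact ⟨p, Or.inr hp, by rw [cat_right hj q, e]⟩
  gap := by
    intro x y c hc
    obtain ⟨γ, L, h, h0, h1, hL⟩ := inner_exists (hJ x x.2 y y.2) hc
    refine ⟨γ, L, h, h0, h1, fun t ht => ⟨⟨γ t, h.mem t ht⟩, ?_, rfl⟩⟩
    have a := inner_le (us_shift h le_rfl ht.1 ht.2) (x := (x : X)) (y := γ t) (by simpa using h0)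
      (by simp)
    have b := inner_le (us_shift h ht.1 ht.2 le_rfl) (x := γ t) (y := (y : X)) (by simp)
      (by simpa using h1)
    show innerDist Ω x (γ t) + innerDist Ω (γ t) y < c
    linarith
  hC := hC
  he := by positivity
  hx0 := by field_simp

theorem geo_of {hJ : Joined' Ω} {C : ℝ} {hC : 1 ≤ C} {x0 : Ω} {hx : 0 < distCompl Ω x0}
    (hGH : GehringHayman Ω C) (hBS : BallSeparation Ω C) {γ : ℝ → X} {L : ℝ}
    (h : IsQHGeodesic Ω γ L) (o : Ω) : (mkCfg hJ C hC x0 hx).Geo (lft o γ) L := by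
  refine ⟨h.1.nonneg, fun s hs t ht hst => ?_⟩
  have hg := geo_sub h hs.1 hst ht.2
  have es := lft_coe o (h.1.mem s hs)
  have et := lft_coe o (h.1.mem t ht)
  have e1 : (fun r => γ (s + r)) (t - s) = γ t := by simp
  have e0 : (fun r => γ (s + r)) 0 = γ s := by simp
  refine ⟨?_, ?_, ?_, ?_⟩
  · show innerDist Ω (lft o γ s) (lft o γ t) ≤ t - s
    rw [es, et]
    exact inner_le hg.1 e0 e1
  · show t - s ≤ C * innerDist Ω (lft o γ s) (lft o γ t)
    rw [es, et]
    have := hGH _ _ hg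
    have this : t - s ≤ C * innerDist Ω ((fun r => γ (s + r)) 0) ((fun r => γ (s + r)) (t - s)) := this
    rw [e1, e0] at this
    exact this
  · refine ⟨_, _, hg.1, e0.trans es.symm, e1.trans et.symm, fun r hr => ?_⟩
    have m : s + r ∈ Set.Icc s t := ⟨by linarith [hr.1], by linarith [hr.2]⟩
    exact ⟨lft o γ (s + r), ⟨_, m, rfl⟩,
      lft_coe o (h.1.mem _ ⟨hs.1.trans m.1, m.2.trans ht.2⟩)⟩
  · rintro z hz S ⟨α, N, hα, h0, h1, hS⟩
    obtain ⟨r, hr, hlt⟩ := hBS _ _ hg (z - s) ⟨by linarith [hz.1], by linarith [hz.2]⟩ α N hα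
      (h0.trans (es.trans e0.symm)) (h1.trans (et.trans e1.symm))
    obtain ⟨p, hp, ep⟩ := hS r hr
    refine ⟨p, hp, ?_⟩
    have ez := lft_coe o (h.1.mem z ⟨hs.1.trans hz.1, hz.2.trans ht.2⟩)
    show innerDist Ω (lft o γ z) p < C * distCompl Ω (lft o γ z)
    rw [ez, ep]
    simpa using hlt

theorem cut_of {hJ : Joined' Ω} {C : ℝ} {hC : 1 ≤ C} {x0 : Ω} {hx : 0 < distCompl Ω x0}
    (hGeo : QHGeodesicSpace Ω)
    (hGH : GehringHayman Ω C) (hBS : BallSeparation Ω C) (q : Ω)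
    (hq : (mkCfg hJ C hC x0 hx).σ x0 q ≤ (mkCfg hJ C hC x0 hx).K)
    (hno : ¬ qhDist Ω x0 q ≤ 50 * C ^ 6 * (3 + C) ^ 2) : (mkCfg hJ C hC x0 hx).Cut q := by
  obtain ⟨β, L, hβ, h0, h1⟩ := hGeo x0 x0.2 q q.2
  have hK : (mkCfg hJ C hC x0 hx).K = 2 * C * distCompl Ω x0 * (1 + C) := rfl
  have hq' : innerDist Ω x0 q ≤ 2 * C * distCompl Ω x0 * (1 + C) := hq
  have hL := hGH _ _ hβ
  rw [h0, h1] at hL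
  have hL' : L ≤ C * (2 * C * distCompl Ω x0 * (1 + C)) :=
    hL.trans (mul_le_mul_of_nonneg_left hq' (by linarith))
  have hn := hβ.1.nonneg
  set e := distCompl Ω x0 / (200 * C ^ 4) with he
  have hepos : 0 < e := by positivity
  have hd : distCompl Ω x0 = 200 * C ^ 4 * e := by rw [he]; field_simp
  by_cases hall : ∀ t ∈ Set.Icc (0:ℝ) L, e ≤ distCompl Ω (β t)
  · exfalso
    apply hno
    have h2 := hβ.2 0 ⟨le_rfl, hn⟩ L ⟨hn, le_rfl⟩ hn
    rw [h0, h1] at h2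
    rw [← h2]
    have h3 := intervalIntegral.norm_integral_le_of_norm_le_const (a := 0) (b := L)
      (f := fun u => 1 / distCompl Ω (β u)) (C := 1 / e) (fun u hu => by
        rw [Set.uIoc_of_le hn] at hu
        have := hall u ⟨hu.1.le, hu.2⟩
        rw [Real.norm_of_nonneg (one_div_nonneg.mpr (hepos.le.trans this))]
        exact one_div_le_one_div_of_le hepos this)
    have h4 := (le_abs_self _).trans h3
    rw [sub_zero, abs_of_nonneg hn] at h4
    refine h4.trans ?_
    rw [one_div_mul_eq_div, div_le_iff₀ hepos]
    refine hL'.trans ?_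
    rw [hd]
    have : 0 ≤ 50 * C ^ 6 * e * (C - 1) ^ 2 := by positivity
    nlinarith
  · push Not at hall
    obtain ⟨t, ht, hlt⟩ := hall
    refine ⟨⟨β t, hβ.1.mem t ht⟩, hlt.le, ?_⟩
    rintro S ⟨α, N, hα, ha0, ha1, hS⟩
    obtain ⟨r, hr, hlt⟩ := hBS _ _ hβ t ht α N hα (ha0.trans h0.symm) (ha1.trans h1.symm)
    obtain ⟨p, hp, ep⟩ := hS r hr
    refine ⟨p, hp, ?_⟩
    show innerDist Ω (β t) p < C * distCompl Ω (β t)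
    rw [ep]
    exact hlt

theorem side_of {Y : Type*} {c : Cfg Y} {γ : ℝ → Y} {L s : ℝ} (h : c.Geo γ L)
    (hs : s ∈ Set.Icc (0:ℝ) L) (h0 : γ s = c.x0)
    (hmono : ∀ x y (S T : Set Y), S ⊆ T → c.P x y S → c.P x y T) :
    c.Side (γ '' Set.Icc 0 s) (γ '' Set.Icc s L) (γ 0) (γ L) := by
  have z : (0:ℝ) ∈ Set.Icc (0:ℝ) L := ⟨le_rfl, h.1⟩
  have l : L ∈ Set.Icc (0:ℝ) L := ⟨h.1, le_rfl⟩
  have hC := c.hC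
  have mM : ∀ r ∈ Set.Icc 0 s, r ∈ Set.Icc (0:ℝ) L := fun r hr => ⟨hr.1, hr.2.trans hs.2⟩
  have mN : ∀ r ∈ Set.Icc s L, r ∈ Set.Icc (0:ℝ) L := fun r hr => ⟨hs.1.trans hr.1, hr.2⟩
  have pm : ∀ x y (S T : Set Y), S ⊆ T → c.P x y S → c.P x y T := hmono
  refine ⟨⟨0, ⟨le_rfl, hs.1⟩, rfl⟩, ⟨L, ⟨hs.2, le_rfl⟩, rfl⟩, ?_, ?_, ?_, ?_, ?_, ?_, ?_⟩
  · rintro _ ⟨a, ha, rfl⟩ _ ⟨b, hb, rfl⟩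
    rw [← h0]
    have k1 := (h.2 a (mM a ha) s hs ha.2).1
    have k2 := (h.2 a (mM a ha) b (mN b hb) (ha.2.trans hb.1)).2.1
    linarith [hb.1]
  · rintro _ ⟨a, ha, rfl⟩ _ ⟨b, hb, rfl⟩
    rw [← h0, c.symm]
    have k1 := (h.2 s hs b (mN b hb) hb.1).1
    have k2 := (h.2 a (mM a ha) b (mN b hb) (ha.2.trans hb.1)).2.1
    linarith [ha.2]
  · rintro _ ⟨a, ha, rfl⟩
    rw [← h0]
    exact pm _ _ _ _ (Set.image_mono (Set.Icc_subset_Icc_left ha.1))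
      (c.psymm _ _ _ (h.2 a (mM a ha) s hs ha.2).2.2.1)
  · rintro _ ⟨b, hb, rfl⟩
    rw [← h0]
    exact pm _ _ _ _ (Set.image_mono (Set.Icc_subset_Icc_right hb.2))
      (h.2 s hs b (mN b hb) hb.1).2.2.1
  · rintro _ ⟨a, ha, rfl⟩
    exact pm _ _ _ _ (Set.image_mono (Set.Icc_subset_Icc_right ha.2))
      (h.2 0 z a (mM a ha) ha.1).2.2.1
  · rintro _ ⟨b, hb, rfl⟩
    exact pm _ _ _ _ (Set.image_mono (Set.Icc_subset_Icc_left hb.1))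
      (c.psymm _ _ _ (h.2 b (mN b hb) L l hb.2).2.2.1)
  · rintro _ ⟨a, ha, rfl⟩ _ ⟨b, hb, rfl⟩ S hS
    have := (h.2 a (mM a ha) b (mN b hb) (ha.2.trans hb.1)).2.2.2 s ⟨ha.2, hb.1⟩ S hS
    rwa [h0] at this

end Concrete

/-- Theorem 1.6: Gehring–Hayman + ball separation imply Gromov
hyperbolicity of `(Ω, k_Ω)` with `δ = 50·C⁶·(3+C)²`. -/
theorem gromovHyperbolic_of_GH_BS (Ω : Set X) (hΩ : IsProperSubdomain Ω)
    (C : ℝ) (hC : 0 < C) (hGeo : QHGeodesicSpace Ω)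
    (hGH : GehringHayman Ω C) (hBS : BallSeparation Ω C) :
    QHGromovHyperbolic Ω (50 * C ^ 6 * (3 + C) ^ 2) := by
  intro γ₁ L₁ γ₂ L₂ γ₃ L₃ h1 h2 h3 e12 e13 e23 s hs
  have n1 := h1.1.nonneg
  have n2 := h2.1.nonneg
  have n3 := h3.1.nonneg
  have hJ : Joined' Ω := fun x hx y hy => by
    obtain ⟨γ, L, h, a, b⟩ := hGeo x hx y hy
    exact ⟨γ, L, h.1, a, b⟩
  rcases n1.eq_or_lt with hz | hpos
  · have hs0 : s = 0 := le_antisymm (by rw [hz]; exact hs.2) hs.1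
    subst hs0
    refine ⟨γ₂ 0, Or.inl ⟨0, ⟨le_rfl, n2⟩, rfl⟩, ?_⟩
    rw [e12, ← h1.2 0 hs 0 hs le_rfl, intervalIntegral.integral_same]
    positivity
  have hC1 : 1 ≤ C := by
    have a := hGH _ _ h1
    have b := inner_le h1.1 rfl rfl
    by_contra hlt
    have : C * innerDist Ω (γ₁ 0) (γ₁ L₁) ≤ C * L₁ := mul_le_mul_of_nonneg_left b hC.le
    nlinarith
  by_contra hno
  push Not at hno
  have hmem := h1.1.mem s hs
  have hx : 0 < distCompl Ω (γ₁ s) := by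
    have hcl : IsClosed Ωᶜ := hΩ.1.isClosed_compl
    have hne : (Ωᶜ).Nonempty := Set.nonempty_compl.mpr hΩ.2.2
    exact (hcl.notMem_iff_infDist_pos hne).mp (fun h => h hmem)
  let x0 : Ω := ⟨γ₁ s, hmem⟩
  have G1 := geo_of (hJ := hJ) (hC := hC1) (x0 := x0) (hx := hx) hGH hBS h1 x0
  have G2 := geo_of (hJ := hJ) (hC := hC1) (x0 := x0) (hx := hx) hGH hBS h2 x0
  have G3 := geo_of (hJ := hJ) (hC := hC1) (x0 := x0) (hx := hx) hGH hBS h3 x0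
  have S := side_of G1 hs (lft_eq x0 hmem) (by
    rintro x y S T hST ⟨γ, L, h, h0, h1, hS⟩
    exact ⟨γ, L, h, h0, h1, fun t ht => by
      obtain ⟨p, hp, e⟩ := hS t ht
      exact ⟨p, hST hp, e⟩⟩)
  have z1 := h1.1.mem 0 ⟨le_rfl, n1⟩
  have z2 := h2.1.mem 0 ⟨le_rfl, n2⟩
  have z3 := h3.1.mem 0 ⟨le_rfl, n3⟩
  have l1 := h1.1.mem L₁ ⟨n1, le_rfl⟩
  have l2 := h2.1.mem L₂ ⟨n2, le_rfl⟩
  have l3 := h3.1.mem L₃ ⟨n3, le_rfl⟩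
  refine Cfg.triangle S G2 G3 ?_ ?_ ?_ ?_ ?_
  · apply Subtype.ext; rw [lft_coe x0 z2, lft_coe x0 z1, e12]
  · apply Subtype.ext; rw [lft_coe x0 z3, lft_coe x0 l1, e13]
  · apply Subtype.ext; rw [lft_coe x0 l2, lft_coe x0 l3, e23]
  · intro t ht hσ
    refine cut_of hGeo hGH hBS _ hσ ?_
    rw [lft_coe x0 (h2.1.mem t ht)]
    exact not_le.mpr (hno _ (Or.inl ⟨t, ht, rfl⟩))
  · intro t ht hσ
    refine cut_of hGeo hGH hBS _ hσ ?_
    rw [lft_coe x0 (h3.1.mem t ht)]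
    exact not_le.mpr (hno _ (Or.inr ⟨t, ht, rfl⟩))
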